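/- arXiv:0806.4500 — 2 statements merged into one kernel-verified Lean document; each statement's English description precedes it below -/
import Mathlib

section
/- Let r ≥ 1, let δ be an integer, and set ρ̂ = (−δ/2, −δ/2 − 1, …, −δ/2 − (r−1)) ∈ ℚ^r. Let λ be a partition with at most r parts, let 1 ≤ i < j ≤ r with (λ+ρ̂)_i + (λ+ρ̂)_j > 0, and let ν ∈ ℚ^r be obtained from λ + ρ̂ by replacing the i-th entry by −(λ+ρ̂)_j and the j-th entry by −(λ+ρ̂)_i (so ν = s_{ε_i+ε_j}(λ+ρ̂)). Assume that the entries of ν are pairwise distinct and all strictly greater than −δ/2 − r. Then μ := sort(ν) − ρ̂ lies in ℤ^r and is a partition with μ ⊊ λ. -/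
/-- Let `δ ∈ ℤ`, `ρ̂ = (−δ/2, −δ/2−1, …, −δ/2−(r−1)) ∈ ℚ^r`, and
let `λ` be a partition with at most `r` parts.  Let `i < j` with
`(λ+ρ̂)_i + (λ+ρ̂)_j > 0` and let `ν = s_{ε_i+ε_j}(λ+ρ̂)` (replace the `i`-th
entry by `−(λ+ρ̂)_j` and the `j`-th entry by `−(λ+ρ̂)_i`).  If the entries of
`ν` are pairwise distinct and all `> −δ/2 − r`, then `μ := sort(ν) − ρ̂`
(where `sort` is the weakly decreasing rearrangement, realized by any
permutation `σ` with `ν ∘ σ` antitone) has integer entries and is a partition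
with `μ ⊊ λ`. -/
theorem stmt10 (r : ℕ) (hr : 1 ≤ r) (δ : ℤ)
    (rhohat : Fin r → ℚ) (hrho : rhohat = fun k : Fin r => -(δ : ℚ)/2 - ((k : ℕ) : ℚ))
    (lam : Fin r → ℤ) (hanti : Antitone lam) (hnonneg : ∀ k, 0 ≤ lam k)
    (x : Fin r → ℚ) (hx : x = fun k => (lam k : ℚ) + rhohat k)
    (i j : Fin r) (hij : i < j) (hpos : 0 < x i + x j)
    (ν : Fin r → ℚ)
    (hν : ν = fun k => if k = i then -(x j) else if k = j then -(x i) else x k)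
    (hdist : Function.Injective ν)
    (hbig : ∀ k, -(δ : ℚ)/2 - r < ν k) :
    ∀ σ : Equiv.Perm (Fin r), Antitone (ν ∘ σ) →
      ∃ mu : Fin r → ℤ,
        (∀ k, (mu k : ℚ) = ν (σ k) - rhohat k) ∧
        Antitone mu ∧ (∀ k, 0 ≤ mu k) ∧
        (∀ k, mu k ≤ lam k) ∧ mu ≠ lam := by
  intro σ hσ
  have hxe : ∀ k, x k = (lam k : ℚ) - (δ : ℚ)/2 - ((k : ℕ) : ℚ) := by
    intro k; rw [hx, hrho]; ring
  have hxa : Antitone x := by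
    intro a b hab
    rw [hxe, hxe]
    have h1 : (lam b : ℚ) ≤ lam a := by exact_mod_cast hanti hab
    have h2 : ((a : ℕ) : ℚ) ≤ ((b : ℕ) : ℚ) := by exact_mod_cast hab
    linarith
  have hle : ∀ k, ν k ≤ x k := by
    intro k
    rw [hν]
    dsimp only
    split_ifs with h1 h2
    · subst h1; linarith
    · subst h2; linarith
    · exact le_rfl
  have hlt : ν i < x i := by
    rw [hν]
    simp only [if_true]
    linarith
  have hint : ∀ k, ∃ n : ℤ, ν k = (n : ℚ) - (δ : ℚ)/2 := by
    intro k
    rw [hν]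
    dsimp only
    split_ifs with h1 h2
    · exact ⟨δ + (j : ℕ) - lam j, by rw [hxe]; push_cast; ring⟩
    · exact ⟨δ + (i : ℕ) - lam i, by rw [hxe]; push_cast; ring⟩
    · exact ⟨lam k - (k : ℕ), by rw [hxe]; push_cast; ring⟩
  choose n hn using hint
  have hsort : ∀ k, ν (σ k) ≤ x k := by
    intro k
    obtain ⟨l, hl, hm⟩ : ∃ l, l ≤ k ∧ k ≤ σ l := by
      by_contra! hcon
      have hc := Finset.card_le_card_of_injOn (s := Finset.Iic k) (t := Finset.Iio k) σ
        (fun a ha => by simpa using hcon a (by simpa using ha)) σ.injective.injOn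
      simp at hc
    exact (hσ hl).trans ((hle _).trans (hxa hm))
  have hstrict : ∀ a b, a < b → n (σ b) < n (σ a) := by
    intro a b hab
    have h1 : ν (σ b) ≤ ν (σ a) := hσ hab.le
    have h2 : ν (σ b) ≠ ν (σ a) := fun h => hab.ne' (σ.injective (hdist h))
    have h3 := lt_of_le_of_ne h1 h2
    rw [hn, hn] at h3
    have h4 : (n (σ b) : ℚ) < n (σ a) := by linarith
    exact_mod_cast h4
  have hmu : ∀ k, ((n (σ k) + ((k : ℕ) : ℤ) : ℤ) : ℚ) = ν (σ k) - rhohat k := by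
    intro k; rw [hn, hrho]; push_cast; ring
  have hmuanti : Antitone (fun k : Fin r => n (σ k) + ((k : ℕ) : ℤ)) := by
    obtain ⟨m, rfl⟩ : ∃ m, r = m + 1 := ⟨r - 1, by omega⟩
    rw [Fin.antitone_iff_succ_le]
    intro a
    have := hstrict a.castSucc a.succ Fin.castSucc_lt_succ
    simp only [Fin.val_succ, Fin.val_castSucc]
    push_cast
    omega
  refine ⟨fun k => n (σ k) + ((k : ℕ) : ℤ), hmu, hmuanti, ?_, ?_, ?_⟩
  · intro k
    have h1 := hmuanti (show k ≤ ⟨r - 1, by omega⟩ from by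
      rw [Fin.le_def]; have := k.isLt; simp only; omega)
    have h2 := hbig (σ ⟨r - 1, by omega⟩)
    rw [hn] at h2
    have h3 : ((-(r : ℤ) : ℤ) : ℚ) < n (σ ⟨r - 1, by omega⟩) := by push_cast; linarith
    have h4 := Int.cast_lt.mp h3
    simp only at h1 ⊢
    omega
  · intro k
    have h1 := hsort k
    have h2 := hmu k
    have h3 : x k = lam k + rhohat k := by rw [hx]
    have h4 : ((n (σ k) + ((k : ℕ) : ℤ) : ℤ) : ℚ) ≤ lam k := by rw [h2]; linarith
    exact_mod_cast h4
  · intro heq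
    have h1 : ∀ k, ν (σ k) = x k := by
      intro k
      have h2 := hmu k
      have h3 : x k = lam k + rhohat k := by rw [hx]
      have h4 := congrFun heq k
      rw [h4] at h2
      linarith
    have h5 : ∑ k, ν k < ∑ k, x k :=
      Finset.sum_lt_sum (fun k _ => hle k) ⟨i, Finset.mem_univ _, hlt⟩
    have h6 : ∑ k, ν (σ k) = ∑ k, ν k := Equiv.sum_comp σ ν
    simp only [h1] at h6
    linarith
end

section
/- Let R be a Dedekind domain with field of fractions K, let A be a finite-dimensional K-algebra which is split (for every simple A-module V, every A-module endomorphism of V is multiplication by a scalar from K), and let Λ be an R-subalgebra of A which is finitely generated as an R-module and whose K-span is all of A. Let V₁, …, V_n be a complete set of pairwise non-isomorphic simple A-modules, and for each i let L_i be a Λ-submodule of V_i which is finitely generated over R and whose K-span is V_i. Then there is a finite set T of maximal ideals of R such that for every maximal ideal M of R not in T, writing F = R/M: the F-algebra F ⊗_R Λ is split, the F ⊗_R Λ-modules F ⊗_R L₁, …, F ⊗_R L_n are simple and pairwise non-isomorphic, and every simple F ⊗_R Λ-module is isomorphic to F ⊗_R L_i for some i. -/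
/-- For an ideal `M` of the base ring `R` and a `Λ`-module `L` (`Λ` an
`R`-algebra), the `Λ`-submodule `M·L` of `L` generated by the `M`-multiples.
The quotient `L ⧸ M·L` is the reduction of `L` mod `M`, canonically isomorphic
to the base change `(R ⧸ M) ⊗[R] L`. -/
def idealSMulSub {R Λ L : Type*} [CommRing R] [Ring Λ] [Algebra R Λ]
    [AddCommGroup L] [Module R L] [Module Λ L] [IsScalarTower R Λ L]
    (M : Ideal R) : Submodule Λ L :=
  Submodule.span Λ {x | ∃ m ∈ M, ∃ y : L, x = m • y}


universe u

section core
variable {R Λ : Type u} [CommRing R] [Ring Λ] [Algebra R Λ]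

section single
variable {L : Type u} [AddCommGroup L] [Module R L] [Module Λ L] [IsScalarTower R Λ L]
  {M : Ideal R}

theorem red_mem {m : R} (hm : m ∈ M) (y : L) :
    m • y ∈ idealSMulSub (R := R) (Λ := Λ) (L := L) M :=
  Submodule.subset_span ⟨m, hm, y, rfl⟩

theorem red_smul_mem (r : R) {y : L} (hy : y ∈ idealSMulSub (R := R) (Λ := Λ) (L := L) M) :
    r • y ∈ idealSMulSub (R := R) (Λ := Λ) (L := L) M := by
  rw [← algebraMap_smul Λ]
  exact Submodule.smul_mem _ _ hy

theorem exists_inv_mod (hM : M.IsMaximal) {q : R} (hq : q ∉ M) : ∃ v : R, v * q - 1 ∈ M := by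
  obtain ⟨v, m, hm, h⟩ := hM.exists_inv hq
  refine ⟨v, ?_⟩
  have : v * q - 1 = - m := by rw [← h]; ring
  rw [this]
  exact M.neg_mem hm

theorem red_cancel (hM : M.IsMaximal) {q : R} (hq : q ∉ M) {y : L}
    (hy : q • y ∈ idealSMulSub (R := R) (Λ := Λ) (L := L) M) :
    y ∈ idealSMulSub (R := R) (Λ := Λ) (L := L) M := by
  obtain ⟨v, hv⟩ := exists_inv_mod hM hq
  have h1 := red_smul_mem (Λ := Λ) v hy
  have h2 := red_mem (Λ := Λ) hv y
  have : y = v • q • y - (v * q - 1) • y := by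
    rw [sub_smul, mul_smul, one_smul]; abel
  rw [this]
  exact Submodule.sub_mem _ h1 h2

theorem lam_smul_comm (a : Λ) (r : R) (y : L) : a • r • y = r • a • y := by
  rw [← algebraMap_smul Λ r y, ← algebraMap_smul Λ r (a • y), ← mul_smul, ← mul_smul,
    Algebra.commutes]

variable {κ : Type} [Fintype κ] [DecidableEq κ] {β : κ → L} {s : R} {lam : κ → κ → Λ}

theorem red_coeff (hgen : ∀ y : L, ∃ c : κ → R, s • y = ∑ k, c k • β k) {x : L}
    (hx : x ∈ idealSMulSub (R := R) (Λ := Λ) (L := L) M) :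
    ∃ c : κ → R, (∀ k, c k ∈ M) ∧ s • x = ∑ k, c k • β k := by
  suffices h : ∀ a : Λ, ∃ c : κ → R, (∀ k, c k ∈ M) ∧ s • (a • x) = ∑ k, c k • β k by
    simpa using h 1
  unfold idealSMulSub at hx
  induction hx using Submodule.span_induction with
  | mem x h =>
    obtain ⟨m, hm, y, rfl⟩ := h
    intro a
    obtain ⟨c, hc⟩ := hgen (a • y)
    refine ⟨fun k => m * c k, fun k => M.mul_mem_right _ hm, ?_⟩
    rw [lam_smul_comm, smul_comm, hc, Finset.smul_sum]
    simp [mul_smul]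
  | zero => intro a; exact ⟨0, by simp, by simp⟩
  | add x y _ _ h1 h2 =>
    intro a
    obtain ⟨c, hc, hc'⟩ := h1 a
    obtain ⟨d, hd, hd'⟩ := h2 a
    refine ⟨c + d, fun k => M.add_mem (hc k) (hd k), ?_⟩
    simp [smul_add, hc', hd', add_smul, Finset.sum_add_distrib]
  | smul b x _ h =>
    intro a
    rw [← mul_smul]
    exact h _

theorem red_beta (hsM : s ∉ M) (hgen : ∀ y : L, ∃ c : κ → R, s • y = ∑ k, c k • β k)
    (hind : LinearIndependent R β) (k : κ) :
    β k ∉ idealSMulSub (R := R) (Λ := Λ) (L := L) M := by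
  intro h
  obtain ⟨c, hc, hc'⟩ := red_coeff hgen h
  have := Fintype.linearIndependent_iff.mp hind (fun j => c j - if j = k then s else 0) (by
    simp [sub_smul, ← hc', ite_smul]) k
  simp only [if_true] at this
  exact hsM (by rw [← sub_eq_zero.mp this]; exact hc k)

theorem lam_sum (hlam : ∀ j k k', lam j k • β k' = if k' = k then s • β j else 0)
    (c : κ → R) (j k : κ) : lam j k • ∑ l, c l • β l = (c k * s) • β j := by
  rw [Finset.smul_sum, Finset.sum_eq_single k]
  · rw [lam_smul_comm, hlam, if_pos rfl, mul_smul]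
  · intro l _ hl
    rw [lam_smul_comm, hlam, if_neg hl, smul_zero]
  · simp

theorem red_simple (hM : M.IsMaximal) (hsM : s ∉ M) [Nonempty κ]
    (hgen : ∀ y : L, ∃ c : κ → R, s • y = ∑ k, c k • β k)
    (hind : LinearIndependent R β)
    (hlam : ∀ j k k', lam j k • β k' = if k' = k then s • β j else 0) :
    IsSimpleModule Λ (L ⧸ idealSMulSub (R := R) (Λ := Λ) (L := L) M) := by
  rw [isSimpleModule_iff_toSpanSingleton_surjective]
  constructor
  · obtain ⟨k⟩ := ‹Nonempty κ›
    refine ⟨Submodule.Quotient.mk (β k), 0, fun h => ?_⟩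
    exact red_beta hsM hgen hind k ((Submodule.Quotient.mk_eq_zero _).mp h)
  · intro x hx z
    obtain ⟨y, rfl⟩ := Submodule.Quotient.mk_surjective _ x
    obtain ⟨z, rfl⟩ := Submodule.Quotient.mk_surjective _ z
    have hy : y ∉ idealSMulSub (R := R) (Λ := Λ) (L := L) M := fun h =>
      hx ((Submodule.Quotient.mk_eq_zero _).mpr h)
    obtain ⟨c, hc⟩ := hgen y
    obtain ⟨d, hd⟩ := hgen z
    have : ∃ k, c k ∉ M := by
      by_contra! h
      apply hy
      apply red_cancel hM hsM
      rw [hc]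
      exact Submodule.sum_mem _ fun k _ => red_mem (h k) _
    obtain ⟨k, hk⟩ := this
    have hq : c k * s * s ∉ M := fun h => by
      rcases hM.isPrime.mem_or_mem h with h | h
      · exact (hM.isPrime.mem_or_mem h).elim hk hsM
      · exact hsM h
    obtain ⟨v, hv⟩ := exists_inv_mod hM hq
    let a : Λ := ∑ j, algebraMap R Λ (d j) * lam j k
    have ha : a • s • y = (c k * s * s) • z := by
      rw [hc, Finset.sum_smul]
      simp only [mul_smul _ (lam _ _), lam_sum hlam, algebraMap_smul]
      rw [mul_smul _ s z, hd, Finset.smul_sum]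
      exact Finset.sum_congr rfl fun j _ => smul_comm _ _ _
    refine ⟨algebraMap R Λ v * a * algebraMap R Λ s, ?_⟩
    rw [LinearMap.toSpanSingleton_apply, ← Submodule.Quotient.mk_smul,
      Submodule.Quotient.eq, mul_smul, mul_smul, algebraMap_smul, algebraMap_smul, ha,
      ← mul_smul]
    have h := red_mem (Λ := Λ) hv z
    rwa [sub_smul, one_smul] at h

theorem red_scalar (hM : M.IsMaximal) (hsM : s ∉ M) [Nonempty κ]
    (hgen : ∀ y : L, ∃ c : κ → R, s • y = ∑ k, c k • β k)
    (hind : LinearIndependent R β)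
    (hlam : ∀ j k k', lam j k • β k' = if k' = k then s • β j else 0)
    (f : (L ⧸ idealSMulSub (R := R) (Λ := Λ) (L := L) M) →ₗ[Λ]
      (L ⧸ idealSMulSub (R := R) (Λ := Λ) (L := L) M)) :
    ∃ r : R, ∀ w, f w = algebraMap R Λ r • w := by
  have := red_simple hM hsM hgen hind hlam
  obtain ⟨k⟩ := ‹Nonempty κ›
  have hb := red_beta (Λ := Λ) hsM hgen hind k
  obtain ⟨y, hy⟩ := Submodule.Quotient.mk_surjective _ (f (Submodule.Quotient.mk (β k)))
  obtain ⟨c, hc⟩ := hgen y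
  have hq : s * s ∉ M := fun h => (hM.isPrime.mem_or_mem h).elim hsM hsM
  obtain ⟨v, hv⟩ := exists_inv_mod hM hq
  have h1 : f (lam k k • Submodule.Quotient.mk (β k)) = lam k k • Submodule.Quotient.mk y := by
    rw [map_smul, hy]
  rw [← Submodule.Quotient.mk_smul, hlam, if_pos rfl, ← algebraMap_smul Λ s (β k),
    Submodule.Quotient.mk_smul, map_smul, ← hy, ← Submodule.Quotient.mk_smul,
    ← Submodule.Quotient.mk_smul, Submodule.Quotient.eq, algebraMap_smul] at h1
  have h2 := red_smul_mem (Λ := Λ) s h1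
  rw [smul_sub, ← lam_smul_comm (lam k k) s y, hc, lam_sum hlam, ← hc] at h2
  have h3 := red_smul_mem (Λ := Λ) v h2
  have h4 := red_mem (Λ := Λ) hv y
  have h5 := Submodule.sub_mem _ h3 h4
  have h6 : f (Submodule.Quotient.mk (β k)) =
      algebraMap R Λ (v * (c k * s)) • Submodule.Quotient.mk (β k) := by
    rw [← hy, ← Submodule.Quotient.mk_smul, Submodule.Quotient.eq, algebraMap_smul]
    convert h5 using 1
    simp only [smul_sub, sub_smul, mul_smul, one_smul]
    abel
  refine ⟨v * (c k * s), fun w => ?_⟩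
  obtain ⟨a, rfl⟩ := IsSimpleModule.toSpanSingleton_surjective Λ
    (fun h => hb ((Submodule.Quotient.mk_eq_zero _).mp h)) w
  rw [LinearMap.toSpanSingleton_apply, map_smul, h6, ← mul_smul, ← mul_smul, Algebra.commutes]

end single

theorem core {n : ℕ} {L : Fin n → Type u}
    [∀ i, AddCommGroup (L i)] [∀ i, Module R (L i)] [∀ i, Module Λ (L i)]
    [∀ i, IsScalarTower R Λ (L i)] {M : Ideal R} (hM : M.IsMaximal) {s : R} (hsM : s ∉ M)
    {κ : Fin n → Type} [∀ i, Fintype (κ i)] [∀ i, DecidableEq (κ i)] [∀ i, Nonempty (κ i)]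
    (β : ∀ i, κ i → L i) (lam : ∀ i, κ i → κ i → Λ)
    (hgen : ∀ i, ∀ y : L i, ∃ c : κ i → R, s • y = ∑ k, c k • β i k)
    (hind : ∀ i, LinearIndependent R (β i))
    (hlam : ∀ i j k k', lam i j k • β i k' = if k' = k then s • β i j else 0)
    (hlam' : ∀ i j k l, l ≠ i → ∀ k', lam i j k • β l k' = 0)
    (hnil : ∀ x : Λ, (∀ i k, x • β i k = 0) → ∀ y, IsNilpotent (y * x)) :
    (∀ (W : Type u) [AddCommGroup W] [Module Λ W], IsSimpleModule Λ W →
          (∀ m ∈ M, ∀ w : W, algebraMap R Λ m • w = 0) →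
          ∀ f : W →ₗ[Λ] W, ∃ r : R, ∀ w : W, f w = algebraMap R Λ r • w) ∧
        (∀ i, IsSimpleModule Λ (L i ⧸ idealSMulSub (R := R) (Λ := Λ) (L := L i) M)) ∧
        (∀ i j, i ≠ j → IsEmpty
          ((L i ⧸ idealSMulSub (R := R) (Λ := Λ) (L := L i) M) ≃ₗ[Λ]
            (L j ⧸ idealSMulSub (R := R) (Λ := Λ) (L := L j) M))) ∧
        (∀ (W : Type u) [AddCommGroup W] [Module Λ W], IsSimpleModule Λ W →
          (∀ m ∈ M, ∀ w : W, algebraMap R Λ m • w = 0) →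
          ∃ i, Nonempty (W ≃ₗ[Λ] (L i ⧸ idealSMulSub (R := R) (Λ := Λ) (L := L i) M))) := by
  have hsimp : ∀ i, IsSimpleModule Λ (L i ⧸ idealSMulSub (R := R) (Λ := Λ) (L := L i) M) :=
    fun i => red_simple hM hsM (hgen i) (hind i) (hlam i)
  have hclass : ∀ (W : Type u) [AddCommGroup W] [Module Λ W], IsSimpleModule Λ W →
          (∀ m ∈ M, ∀ w : W, algebraMap R Λ m • w = 0) →
          ∃ i, Nonempty (W ≃ₗ[Λ] (L i ⧸ idealSMulSub (R := R) (Λ := Λ) (L := L i) M)) := by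
    intro W _ _ hW hMW
    have kill : ∀ x : Λ, (∀ i k, x • β i k = 0) → ∀ w : W, x • w = 0 := by
      intro x hx w
      by_contra hne
      obtain ⟨y, hy⟩ := IsSimpleModule.toSpanSingleton_surjective Λ hne w
      rw [LinearMap.toSpanSingleton_apply, ← mul_smul] at hy
      obtain ⟨N, hN⟩ := hnil x hx y
      have : ∀ N : ℕ, (y * x) ^ N • w = w := by
        intro N
        induction N with
        | zero => simp
        | succ N ih => rw [pow_succ, mul_smul, hy, ih]
      have h := this N
      rw [hN, zero_smul] at h
      apply hne
      rw [← h, smul_zero]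
    have scancel : ∀ w : W, algebraMap R Λ s • w = 0 → w = 0 := by
      intro w hw
      obtain ⟨v, hv⟩ := exists_inv_mod hM hsM
      have h := hMW _ hv w
      rw [map_sub, map_mul, map_one, sub_smul, mul_smul, hw, smul_zero, zero_sub, one_smul,
        neg_eq_zero] at h
      exact h
    have := hW.nontrivial
    obtain ⟨w0, hw0⟩ := exists_ne (0 : W)
    obtain ⟨i, j, hij⟩ : ∃ i j, lam i j j • w0 ≠ 0 := by
      by_contra! h
      apply hw0
      apply scancel
      have h1 := kill (algebraMap R Λ s - ∑ i, ∑ j, lam i j j) (by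
        intro l k
        rw [sub_smul, algebraMap_smul, Finset.sum_smul, Finset.sum_eq_single l]
        · simp [Finset.sum_smul, hlam]
        · intro i _ hi
          rw [Finset.sum_smul]
          exact Finset.sum_eq_zero fun j _ => hlam' i j j l hi.symm k
        · simp) w0
      simpa [sub_smul, Finset.sum_smul, h] using h1
    refine ⟨i, ?_⟩
    have hb : (Submodule.Quotient.mk (β i j) :
        L i ⧸ idealSMulSub (R := R) (Λ := Λ) (L := L i) M) ≠ 0 := fun h =>
      red_beta hsM (hgen i) (hind i) j ((Submodule.Quotient.mk_eq_zero _).mp h)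
    have := hsimp i
    have hmax := IsSimpleModule.ker_toSpanSingleton_isMaximal Λ hb
    have hmax' := IsSimpleModule.ker_toSpanSingleton_isMaximal Λ hij
    have hle : LinearMap.ker (LinearMap.toSpanSingleton Λ _ (Submodule.Quotient.mk (β i j) :
        L i ⧸ idealSMulSub (R := R) (Λ := Λ) (L := L i) M)) ≤
        LinearMap.ker (LinearMap.toSpanSingleton Λ _ (lam i j j • w0)) := by
      intro a ha
      rw [LinearMap.mem_ker, LinearMap.toSpanSingleton_apply] at ha ⊢
      rw [← Submodule.Quotient.mk_smul, Submodule.Quotient.mk_eq_zero] at ha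
      obtain ⟨m, hm, hm'⟩ := red_coeff (hgen i) ha
      apply scancel
      have h1 := kill (algebraMap R Λ s * (a * lam i j j) -
          ∑ k, algebraMap R Λ (m k) * lam i k j) (by
        intro l k
        by_cases hl : l = i
        · subst hl
          simp only [sub_smul, mul_smul, hlam, Finset.sum_smul]
          split_ifs with hk
          · rw [lam_smul_comm, algebraMap_smul, hm', Finset.smul_sum, sub_eq_zero]
            refine Finset.sum_congr rfl fun k _ => ?_
            rw [algebraMap_smul, smul_comm]
          · simp
        · simp [sub_smul, mul_smul, Finset.sum_smul, hlam' i _ _ l hl k]) w0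
      rw [sub_smul, Finset.sum_smul, Finset.sum_eq_zero, sub_zero, mul_smul, mul_smul] at h1
      · exact h1
      · intro k _
        rw [mul_smul]
        exact hMW _ (hm k) _
    have heq := hmax.eq_of_le hmax'.ne_top hle
    exact ⟨((LinearMap.quotKerEquivOfSurjective _
        (IsSimpleModule.toSpanSingleton_surjective Λ hij)).symm.trans
      (Submodule.quotEquivOfEq _ _ heq.symm)).trans
      (LinearMap.quotKerEquivOfSurjective _ (IsSimpleModule.toSpanSingleton_surjective Λ hb))⟩
  refine ⟨?_, hsimp, ?_, hclass⟩
  · intro W _ _ hW hMW f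
    obtain ⟨i, ⟨φ⟩⟩ := hclass W hW hMW
    obtain ⟨r, hr⟩ := red_scalar hM hsM (hgen i) (hind i) (hlam i)
      (φ.toLinearMap ∘ₗ f ∘ₗ φ.symm.toLinearMap)
    refine ⟨r, fun w => ?_⟩
    have h := hr (φ w)
    simp only [LinearMap.comp_apply, LinearEquiv.coe_coe, LinearEquiv.symm_apply_apply] at h
    rw [← map_smul] at h
    exact φ.injective h
  · intro i l hil
    refine ⟨fun φ => ?_⟩
    obtain ⟨j⟩ := ‹∀ i, Nonempty (κ i)› i
    have hz : ∀ z : L l, lam i j j • z ∈ idealSMulSub (R := R) (Λ := Λ) (L := L l) M := by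
      intro z
      apply red_cancel hM hsM
      obtain ⟨c, hc⟩ := hgen l z
      rw [← lam_smul_comm, hc, Finset.smul_sum]
      simp [lam_smul_comm, hlam' i j j l hil.symm]
    have h1 : lam i j j • (Submodule.Quotient.mk (β i j) :
        L i ⧸ idealSMulSub (R := R) (Λ := Λ) (L := L i) M) = 0 := by
      apply φ.injective
      rw [map_smul, map_zero]
      obtain ⟨z, hz'⟩ := Submodule.Quotient.mk_surjective _ (φ (Submodule.Quotient.mk (β i j)))
      rw [← hz', ← Submodule.Quotient.mk_smul, Submodule.Quotient.mk_eq_zero]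
      exact hz z
    rw [← Submodule.Quotient.mk_smul, Submodule.Quotient.mk_eq_zero, hlam, if_pos rfl] at h1
    exact red_beta hsM (hgen i) (hind i) j (red_cancel hM hsM h1)

end core

section aux

theorem exists_common {R : Type*} [CommRing R] [IsDomain R] {ι : Type*} [Finite ι]
    (P : ι → R → Prop) (hP : ∀ i s t, P i s → P i (t * s))
    (h : ∀ i, ∃ s, s ≠ 0 ∧ P i s) : ∃ s, s ≠ 0 ∧ ∀ i, P i s := by
  classical
  have := Fintype.ofFinite ι
  choose s hs hs' using h
  refine ⟨∏ i, s i, Finset.prod_ne_zero_iff.mpr fun i _ => hs i, fun i => ?_⟩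
  rw [← Finset.prod_erase_mul _ _ (Finset.mem_univ i)]
  exact hP _ _ _ (hs' i)

theorem clear_denoms {R K N X : Type*} [CommRing R] [IsDomain R] [Field K] [Algebra R K]
    [IsFractionRing R K] [AddCommGroup N] [Module R N] [AddCommGroup X] [Module R X]
    [Module K X] [IsScalarTower R K X] (g : N →ₗ[R] X)
    (hg : Submodule.span K (Set.range g) = ⊤) (x : X) :
    ∃ s : R, s ≠ 0 ∧ ∃ y, g y = s • x := by
  have hx : x ∈ Submodule.span K (Set.range g) := hg ▸ Submodule.mem_top
  induction hx using Submodule.span_induction with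
  | mem x h => obtain ⟨y, rfl⟩ := h; exact ⟨1, one_ne_zero, y, by simp⟩
  | zero => exact ⟨1, one_ne_zero, 0, by simp⟩
  | add x x' _ _ h1 h2 =>
    obtain ⟨s, hs, y, hy⟩ := h1
    obtain ⟨t, ht, z, hz⟩ := h2
    refine ⟨s * t, mul_ne_zero hs ht, t • y + s • z, ?_⟩
    rw [map_add, map_smul, map_smul, hy, hz, smul_add, mul_smul, mul_smul, smul_comm t s x]
  | smul c x _ h =>
    obtain ⟨s, hs, y, hy⟩ := h
    obtain ⟨p, q, hq, rfl⟩ := IsFractionRing.div_surjective (A := R) c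
    have hq0 : q ≠ 0 := nonZeroDivisors.ne_zero hq
    refine ⟨q * s, mul_ne_zero hq0 hs, p • y, ?_⟩
    have hq1 : algebraMap R K q ≠ 0 := by simpa using hq0
    rw [map_smul, hy, ← algebraMap_smul K, ← algebraMap_smul K s x,
      ← algebraMap_smul K (q * s), ← mul_smul, ← mul_smul, map_mul]
    congr 1
    field_simp

/-- A basis lying in a full lattice. -/
theorem exists_lattice_basis {R K N X : Type*} [CommRing R] [IsDomain R] [Field K] [Algebra R K]
    [IsFractionRing R K] [AddCommGroup N] [Module R N] [AddCommGroup X] [Module R X]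
    [Module K X] [IsScalarTower R K X] [FiniteDimensional K X] (g : N →ₗ[R] X)
    (hg : Submodule.span K (Set.range g) = ⊤) :
    ∃ (b : Module.Basis (Fin (Module.finrank K X)) K X)
      (β : Fin (Module.finrank K X) → N), ∀ k, g (β k) = b k := by
  let b0 := Module.finBasis K X
  choose s hs β hβ using fun k => clear_denoms g hg (b0 k)
  have hs' : ∀ k, algebraMap R K (s k) ≠ 0 := fun k => by simpa using hs k
  refine ⟨b0.unitsSMul fun k => Units.mk0 _ (hs' k), β, fun k => ?_⟩
  rw [hβ, Module.Basis.unitsSMul_apply, Units.smul_mk0, algebraMap_smul]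

/-- Denominators of a lattice with respect to a basis contained in it. -/
theorem lattice_denoms {R K N X κ : Type*} [CommRing R] [IsDomain R] [Field K] [Algebra R K]
    [IsFractionRing R K] [AddCommGroup N] [Module R N] [Module.Finite R N]
    [AddCommGroup X] [Module R X]
    [Module K X] [IsScalarTower R K X] [Fintype κ] (g : N →ₗ[R] X) (hinj : Function.Injective g)
    (b : Module.Basis κ K X) (β : κ → N) (hβ : ∀ k, g (β k) = b k) :
    ∃ s : R, s ≠ 0 ∧ ∀ y : N, ∃ c : κ → R, s • y = ∑ k, c k • β k := by
  obtain ⟨S, hS⟩ := Module.Finite.fg_top (R := R) (M := N)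
  let h : (κ → R) →ₗ[R] X := g ∘ₗ Fintype.linearCombination R β
  have hh : Submodule.span K (Set.range h) = ⊤ := by
    classical
    rw [eq_top_iff, ← b.span_eq]
    apply Submodule.span_mono
    rintro _ ⟨k, rfl⟩
    exact ⟨Pi.single k 1, by simp [h, hβ]⟩
  obtain ⟨s, hs, hs'⟩ := exists_common (R := R) (ι := S)
    (fun y s => ∃ c : κ → R, s • y.1 = ∑ k, c k • β k)
    (by
      rintro y s t ⟨c, hc⟩
      refine ⟨fun k => t * c k, ?_⟩
      rw [mul_smul, hc, Finset.smul_sum]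
      simp [mul_smul])
    (by
      intro y
      obtain ⟨s, hs, c, hc⟩ := clear_denoms h hh (g y)
      refine ⟨s, hs, c, hinj ?_⟩
      rw [map_smul, ← hc]
      simp [h, Fintype.linearCombination_apply])
  refine ⟨s, hs, fun y => ?_⟩
  have hy : y ∈ Submodule.span R (S : Set N) := hS ▸ Submodule.mem_top
  induction hy using Submodule.span_induction with
  | mem x hx => exact hs' ⟨x, hx⟩
  | zero => exact ⟨0, by simp⟩
  | add x z _ _ h1 h2 =>
    obtain ⟨c, hc⟩ := h1
    obtain ⟨d, hd⟩ := h2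
    exact ⟨c + d, by simp [hc, hd, add_smul, Finset.sum_add_distrib]⟩
  | smul a x _ h1 =>
    obtain ⟨c, hc⟩ := h1
    refine ⟨fun k => a * c k, ?_⟩
    rw [smul_comm, hc, Finset.smul_sum]
    simp [mul_smul]

theorem density {K A : Type u} [Field K] [Ring A] [Algebra K A]
    (hsplit : ∀ (V : Type u) [AddCommGroup V] [Module A V], IsSimpleModule A V →
      ∀ f : V →ₗ[A] V, ∃ c : K, ∀ v : V, f v = algebraMap K A c • v)
    {n : ℕ} {V : Fin n → Type u}
    [∀ i, AddCommGroup (V i)] [∀ i, Module A (V i)] [∀ i, IsSimpleModule A (V i)]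
    [∀ i, Module K (V i)] [∀ i, IsScalarTower K A (V i)]
    (hpair : ∀ i j, i ≠ j → IsEmpty (V i ≃ₗ[A] V j))
    {κ : Fin n → Type} [∀ i, Fintype (κ i)] (b : ∀ i, κ i → V i)
    (i : Fin n) (f : V i →ₗ[K] V i) :
    ∃ a : A, (∀ k, a • b i k = f (b i k)) ∧ ∀ l, l ≠ i → ∀ k, a • b l k = 0 := by
  classical
  have hscal : ∀ (g : Module.End A (∀ i, V i)) (l : Fin n), ∃ c : K, ∀ v, g v l = c • v l := by
    intro g l
    obtain ⟨c, hc⟩ := hsplit (V l) inferInstance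
      (LinearMap.proj l ∘ₗ g ∘ₗ LinearMap.single A V l)
    refine ⟨c, fun v => ?_⟩
    have hv : v = ∑ j, Pi.single j (v j) := (Finset.univ_sum_single v).symm
    conv_lhs => rw [hv]
    rw [map_sum, Finset.sum_apply, Finset.sum_eq_single l]
    · rw [← algebraMap_smul A c]
      exact hc (v l)
    · intro j _ hj
      have h0 : (LinearMap.proj l ∘ₗ g ∘ₗ LinearMap.single A V j : V j →ₗ[A] V l) = 0 := by
        refine (LinearMap.bijective_or_eq_zero _).resolve_left fun hb => ?_
        exact (hpair j l hj).false (LinearEquiv.ofBijective _ hb)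
      exact LinearMap.congr_fun h0 (v j)
    · simp
  let F : Module.End (Module.End A (∀ i, V i)) (∀ i, V i) :=
    { toFun := fun v => Pi.single i (f (v i))
      map_add' := fun v w => by simp [Pi.single_add]
      map_smul' := fun g v => by
        ext l
        obtain ⟨c, hc⟩ := hscal g l
        simp only [Module.End.smul_def, RingHom.id_apply]
        rw [hc]
        by_cases hl : l = i
        · subst hl
          rw [hc]
          simp
        · simp [hl] }
  obtain ⟨a, ha⟩ := jacobson_density (R := A) F
    (Finset.univ.image fun p : Σ i, κ i => (Pi.single p.1 (b p.1 p.2) : ∀ i, V i))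
  have ha' : ∀ l k, (Pi.single i (f ((Pi.single l (b l k) : ∀ i, V i) i)) : ∀ i, V i) =
      a • Pi.single l (b l k) := fun l k =>
    ha _ (Finset.mem_image.mpr ⟨⟨l, k⟩, Finset.mem_univ _, rfl⟩)
  refine ⟨a, fun k => ?_, fun l hl k => ?_⟩
  · have := congr_fun (ha' i k) i
    simpa using this.symm
  · have := congr_fun (ha' l k) l
    simpa [hl, hl.symm] using this.symm

theorem nilp {A : Type u} [Ring A] [IsArtinianRing A]
    (x : A) (hx : ∀ (W : Type u) [AddCommGroup W] [Module A W], IsSimpleModule A W →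
      ∀ w : W, x • w = 0) (y : A) : IsNilpotent (y * x) := by
  have hmem : x ∈ Ring.jacobson A := by
    rw [Ring.jacobson_eq_sInf_isMaximal, Submodule.mem_sInf]
    intro I hI
    have hs : IsSimpleModule A (A ⧸ I) :=
      isSimpleModule_iff_isCoatom.mpr (Ideal.isMaximal_def.mp hI)
    have h := hx (A ⧸ I) hs (Submodule.Quotient.mk 1)
    rw [← Submodule.Quotient.mk_smul, Submodule.Quotient.mk_eq_zero] at h
    simpa using h
  obtain ⟨N, hN⟩ := IsSemiprimaryRing.isNilpotent (R := A)
  refine ⟨N, ?_⟩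
  have h := Ideal.pow_mem_pow (Ideal.mul_mem_left _ y hmem) N
  rw [hN] at h
  simpa using h

theorem finite_max {R : Type u} [CommRing R] [IsDedekindDomain R] {s : R} (hs : s ≠ 0) :
    {M : Ideal R | M.IsMaximal ∧ s ∈ M}.Finite := by
  have h := Ideal.finite_factors (R := R) (I := Ideal.span {s}) (by simpa using hs)
  refine (h.image fun v => v.asIdeal).subset ?_
  rintro M ⟨hM, hsM⟩
  refine ⟨⟨M, hM.isPrime, ?_⟩, ?_, rfl⟩
  · rintro rfl
    exact hs (by simpa using hsM)
  · simpa [Ideal.dvd_span_singleton] using hsM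

end aux


/-- Let `R` be a Dedekind domain with fraction field `K`, `A` a
finite dimensional split `K`-algebra, `Λ` an order in `A` (an `R`-subalgebra,
given here by an injective `R`-algebra map `ι : Λ → A`, finitely generated over
`R` and spanning `A` over `K`), `V₁, …, V_n` a complete set of pairwise
non-isomorphic simple `A`-modules and `L_i ⊆ V_i` a full `Λ`-lattice (given by
an injective `R`-linear, `Λ`-equivariant map `e i : L i → V i` with `K`-span
everything, `L i` finitely generated over `R`).  Then for all but finitely many
maximal ideals `M` of `R`, writing `F = R ⧸ M`, the `F`-algebra `F ⊗[R] Λ` is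
split and `F ⊗[R] L₁, …, F ⊗[R] L_n` is a complete set of pairwise
non-isomorphic simple `F ⊗[R] Λ`-modules.

Here the modules over `F ⊗[R] Λ = Λ/MΛ` are identified, as usual, with the
`Λ`-modules annihilated by `M`, and the base change `F ⊗[R] L_i` is realized as
the reduction `L_i ⧸ M·L_i`; splitness of `F ⊗[R] Λ` says that every
`Λ`-endomorphism of a simple `Λ`-module annihilated by `M` is multiplication by
a scalar from `F`, i.e. by (the image of) some `r ∈ R`. -/
theorem stmt18
    (R : Type u) [CommRing R] [IsDedekindDomain R]
    (K : Type u) [Field K] [Algebra R K] [IsFractionRing R K]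
    (A : Type u) [Ring A] [Algebra K A] [FiniteDimensional K A]
    [Algebra R A] [IsScalarTower R K A]
    -- `A` is split over `K`:
    (hsplit : ∀ (V : Type u) [AddCommGroup V] [Module A V], IsSimpleModule A V →
      ∀ f : V →ₗ[A] V, ∃ c : K, ∀ v : V, f v = algebraMap K A c • v)
    -- `Λ` is an order in `A`:
    (Λ : Type u) [Ring Λ] [Algebra R Λ] [Module.Finite R Λ]
    (ι : Λ →ₐ[R] A) (hι : Function.Injective ι)
    (hspan : Submodule.span K (Set.range ι) = ⊤)
    -- a complete set of pairwise non-isomorphic simple `A`-modules: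
    (n : ℕ) (V : Fin n → Type u)
    [∀ i, AddCommGroup (V i)] [∀ i, Module A (V i)] [∀ i, IsSimpleModule A (V i)]
    [∀ i, Module K (V i)] [∀ i, Module R (V i)]
    [∀ i, IsScalarTower R K (V i)] [∀ i, IsScalarTower K A (V i)]
    (hpair : ∀ i j, i ≠ j → IsEmpty (V i ≃ₗ[A] V j))
    (hcompl : ∀ (W : Type u) [AddCommGroup W] [Module A W], IsSimpleModule A W →
      ∃ i, Nonempty (W ≃ₗ[A] V i))
    -- full `Λ`-lattices `L i` in `V i`:
    (L : Fin n → Type u)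
    [∀ i, AddCommGroup (L i)] [∀ i, Module R (L i)] [∀ i, Module Λ (L i)]
    [∀ i, IsScalarTower R Λ (L i)] [∀ i, Module.Finite R (L i)]
    (e : ∀ i, L i →ₗ[R] V i) (he : ∀ i, Function.Injective (e i))
    (hcompat : ∀ i (a : Λ) (x : L i), e i (a • x) = ι a • e i x)
    (heSpan : ∀ i, Submodule.span K (Set.range (e i)) = ⊤) :
    ∃ T : Finset (Ideal R), (∀ M ∈ T, M.IsMaximal) ∧
      ∀ M : Ideal R, M.IsMaximal → M ∉ T →
        -- `F ⊗[R] Λ` is split: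
        (∀ (W : Type u) [AddCommGroup W] [Module Λ W], IsSimpleModule Λ W →
          (∀ m ∈ M, ∀ w : W, algebraMap R Λ m • w = 0) →
          ∀ f : W →ₗ[Λ] W, ∃ r : R, ∀ w : W, f w = algebraMap R Λ r • w) ∧
        -- the modules `F ⊗[R] L i = L i ⧸ M·L i` are simple:
        (∀ i, IsSimpleModule Λ (L i ⧸ idealSMulSub (R := R) (Λ := Λ) (L := L i) M)) ∧
        -- and pairwise non-isomorphic:
        (∀ i j, i ≠ j → IsEmpty
          ((L i ⧸ idealSMulSub (R := R) (Λ := Λ) (L := L i) M) ≃ₗ[Λ]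
            (L j ⧸ idealSMulSub (R := R) (Λ := Λ) (L := L j) M))) ∧
        -- every simple `F ⊗[R] Λ`-module is one of them:
        (∀ (W : Type u) [AddCommGroup W] [Module Λ W], IsSimpleModule Λ W →
          (∀ m ∈ M, ∀ w : W, algebraMap R Λ m • w = 0) →
          ∃ i, Nonempty (W ≃ₗ[Λ] (L i ⧸ idealSMulSub (R := R) (Λ := Λ) (L := L i) M))) := by
  classical
  have hfd : ∀ i, FiniteDimensional K (V i) := fun i => Module.Finite.trans A (V i)
  have hnt : ∀ i, Nontrivial (V i) := fun i => IsSimpleModule.nontrivial A (V i)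
  choose b β hβ using fun i => exists_lattice_basis (K := K) (e i) (heSpan i)
  have hne : ∀ i, Nonempty (Fin (Module.finrank K (V i))) := fun i =>
    Fin.pos_iff_nonempty.mp Module.finrank_pos
  -- lattice denominators
  obtain ⟨s1, hs1, hgen1⟩ := exists_common (R := R)
    (fun i s => ∀ y : L i, ∃ c : Fin (Module.finrank K (V i)) → R, s • y = ∑ k, c k • β i k)
    (by
      intro i s t h y
      obtain ⟨c, hc⟩ := h y
      refine ⟨fun k => t * c k, ?_⟩
      rw [mul_smul, hc, Finset.smul_sum]
      simp [mul_smul])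
    (fun i => lattice_denoms (e i) (he i) (b i) (β i) (hβ i))
  -- matrix units
  obtain ⟨s2, hs2, hunit⟩ := exists_common (R := R)
    (ι := Σ i, Fin (Module.finrank K (V i)) × Fin (Module.finrank K (V i)))
    (fun p s => ∃ x : Λ, (∀ k', x • β p.1 k' = if k' = p.2.2 then s • β p.1 p.2.1 else 0) ∧
      ∀ l, l ≠ p.1 → ∀ k', x • β l k' = 0)
    (by
      rintro p s t ⟨x, h1, h2⟩
      refine ⟨algebraMap R Λ t * x, fun k' => ?_, fun l hl k' => ?_⟩
      · rw [mul_smul, h1, algebraMap_smul]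
        split_ifs
        · rw [mul_smul]
        · simp
      · rw [mul_smul, h2 l hl, smul_zero])
    (by
      rintro ⟨i, j, k⟩
      obtain ⟨a, ha, ha'⟩ := density hsplit hpair (fun i => b i) i
        ((b i).constr K fun k' => if k' = k then b i j else 0)
      obtain ⟨s, hs, x, hx⟩ := clear_denoms (K := K) ι.toLinearMap hspan a
      have hsm : ∀ l (v : V l), ι x • v = s • a • v := by
        intro l v
        have hx' : ι x = s • a := hx
        rw [hx', ← algebraMap_smul K s a, smul_assoc, algebraMap_smul]
      refine ⟨s, hs, x, fun k' => he i ?_, fun l hl k' => he l ?_⟩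
      · rw [hcompat, hβ, hsm, ha, Module.Basis.constr_basis]
        dsimp only
        split_ifs
        · rw [map_smul, hβ]
        · simp
      · rw [hcompat, hβ, hsm, ha' l hl, smul_zero, map_zero])
  have hs : s1 * s2 ≠ 0 := mul_ne_zero hs1 hs2
  choose x hx hx' using hunit
  have hfin := finite_max hs
  refine ⟨hfin.toFinset, fun M h => ((Set.Finite.mem_toFinset _).mp h).1, fun M hM hMT => ?_⟩
  have hsM : s1 * s2 ∉ M := fun h => hMT ((Set.Finite.mem_toFinset _).mpr ⟨hM, h⟩)
  have : IsArtinianRing A := IsArtinianRing.of_finite K A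
  refine core hM hsM β (fun i j k => algebraMap R Λ s1 * x ⟨i, j, k⟩) ?_ ?_ ?_ ?_ ?_
  · intro i y
    obtain ⟨c, hc⟩ := hgen1 i (s2 • y)
    exact ⟨c, by rw [mul_smul, hc]⟩
  · intro i
    have h : LinearIndependent R (e i ∘ β i) := by
      have h2 : e i ∘ β i = b i := funext (hβ i)
      rw [h2]
      exact (b i).linearIndependent.restrict_scalars (by
        intro r r' h
        simpa [Algebra.smul_def] using h)
    exact h.of_comp
  · intro i j k k'
    rw [mul_smul, hx, algebraMap_smul]
    split_ifs
    · rw [mul_smul]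
    · simp
  · intro i j k l hl k'
    rw [mul_smul, hx' ⟨i, j, k⟩ l hl, smul_zero]
  · intro z hz y
    have hV : ∀ i (v : V i), ι z • v = 0 := by
      intro i v
      let φ : V i →ₗ[K] V i :=
        { toFun := fun v => ι z • v
          map_add' := smul_add _
          map_smul' := fun c v => by
            simp only [RingHom.id_apply]
            rw [← algebraMap_smul A c v, ← algebraMap_smul A c (ι z • v), ← mul_smul, ← mul_smul,
              Algebra.commutes] }
      have : φ = 0 := (b i).ext fun k => by
        change ι z • b i k = 0
        rw [← hβ, ← hcompat, hz, map_zero]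
      exact LinearMap.congr_fun this v
    obtain ⟨N, hN⟩ := nilp (ι z) (by
      intro W _ _ hW w
      obtain ⟨i, ⟨φ⟩⟩ := hcompl W hW
      apply φ.injective
      rw [map_smul, hV, map_zero]) (ι y)
    refine ⟨N, hι ?_⟩
    rw [map_pow, map_mul, hN, map_zero]
end
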